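/- There exist universal constants C and D₀ such that for every finite set Ē₀ ⊂ ℝ there is a family of maps {Ξ±ᵗ : t ∈ ℝ}, where each Ξ±ᵗ is a linear map from C²(Ē₀) into the space of single-variable real polynomials of degree at most 2, satisfying: (A) for each t ∈ ℝ there is a set S̄(t) ⊆ Ē₀ with #S̄(t) ≤ D₀ such that Ξ±ᵗ(f) depends only on f|_{S̄(t)}; (B) for every f ∈ C²(Ē₀) there exists F ∈ C²(ℝ) such that the degree-2 Taylor polynomial of F at t equals Ξ±ᵗ(f) for every t ∈ ℝ, ‖F‖_{C²(ℝ)} ≤ C·‖f‖_{C²(Ē₀)}, and F(t) = f(t) for all t ∈ Ē₀. -/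

import Mathlib

/-- `F : ℝ → ℝ` is twice continuously differentiable with `|F|, |F'|, |F''|`
bounded by `M`; this encodes `‖F‖_{C²(ℝ)} ≤ M`. -/
def C2BddBy1 (F : ℝ → ℝ) (M : ℝ) : Prop :=
  ContDiff ℝ 2 F ∧ ∀ t : ℝ, |F t| ≤ M ∧ |deriv F t| ≤ M ∧ |deriv (deriv F) t| ≤ M

/-- The one-dimensional trace norm `‖f‖_{C²(Ē₀)}` (no sign constraint). -/
noncomputable def traceNorm1 (E : Set ℝ) (f : ℝ → ℝ) : ℝ :=
  sInf {M : ℝ | 0 ≤ M ∧ ∃ F : ℝ → ℝ, (∀ t ∈ E, F t = f t) ∧ C2BddBy1 F M}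

/-- A smooth step equal to `0` for `u ≤ 1/3` and to `1` for `u ≥ 2/3`. -/
noncomputable def smoothStep (u : ℝ) : ℝ := Real.smoothTransition (3 * u - 1)

/-- The function that passes smoothly from `P` (left of `a`) to `Q` (right of `b`). -/
noncomputable def blend (a b : ℝ) (P Q : ℝ → ℝ) (t : ℝ) : ℝ :=
  P t + smoothStep ((t - a) / (b - a)) * (Q t - P t)

lemma contDiff_smoothStep : ContDiff ℝ 2 smoothStep :=
  Real.smoothTransition.contDiff.comp (by fun_prop : ContDiff ℝ 2 fun u : ℝ => 3 * u - 1)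

lemma smoothStep_eq_zero {u : ℝ} (hu : u ≤ 1 / 3) : smoothStep u = 0 :=
  Real.smoothTransition.zero_of_nonpos (by linarith)

lemma smoothStep_eq_one {u : ℝ} (hu : 2 / 3 ≤ u) : smoothStep u = 1 :=
  Real.smoothTransition.one_of_one_le (by linarith)

lemma abs_smoothStep_le_one (u : ℝ) : |smoothStep u| ≤ 1 := by
  rw [smoothStep, abs_of_nonneg (Real.smoothTransition.nonneg _)]
  exact Real.smoothTransition.le_one _

lemma exists_bound_of_hasCompactSupport {F : ℝ → ℝ} (hF : Continuous F)
    (hc : HasCompactSupport F) : ∃ M, ∀ t, |F t| ≤ M :=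
  hF.bounded_above_of_compact_support hc

lemma ContDiff.deriv_of_two {F : ℝ → ℝ} (hF : ContDiff ℝ 2 F) : ContDiff ℝ 1 (deriv F) :=
  ContDiff.iterate_deriv' 1 1 hF

lemma exists_bound_deriv_smoothStep :
    ∃ K : ℝ, 0 ≤ K ∧ ∀ u, |deriv smoothStep u| ≤ K ∧ |deriv (deriv smoothStep) u| ≤ K := by
  have hsupp : HasCompactSupport (deriv smoothStep) := by
    refine HasCompactSupport.intro (isCompact_Icc (a := (0 : ℝ)) (b := 1)) fun u hu => ?_
    rcases lt_or_ge u 0 with h | h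
    · have : smoothStep =ᶠ[nhds u] fun _ => 0 := by
        filter_upwards [Iio_mem_nhds h] with v hv
        exact smoothStep_eq_zero (by linarith [Set.mem_Iio.1 hv])
      simpa using this.deriv_eq
    · have h1 : 1 < u := by
        by_contra! h'
        exact hu ⟨h, h'⟩
      have : smoothStep =ᶠ[nhds u] fun _ => 1 := by
        filter_upwards [Ioi_mem_nhds h1] with v hv
        exact smoothStep_eq_one (by linarith [Set.mem_Ioi.1 hv])
      simpa using this.deriv_eq
  obtain ⟨K₁, h₁⟩ := exists_bound_of_hasCompactSupport
    contDiff_smoothStep.deriv_of_two.continuous hsupp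
  obtain ⟨K₂, h₂⟩ := exists_bound_of_hasCompactSupport
    (contDiff_smoothStep.deriv_of_two.continuous_deriv le_rfl) hsupp.deriv
  exact ⟨max K₁ K₂, (abs_nonneg _).trans ((h₁ 0).trans (le_max_left _ _)),
    fun u => ⟨(h₁ u).trans (le_max_left _ _), (h₂ u).trans (le_max_right _ _)⟩⟩

/-- Gluing of a family of functions indexed by a finite set, linearly in a parameter `v`. -/
lemma exists_glue {V : Type*} [AddCommGroup V] [Module ℝ V] (G : ℝ → V →ₗ[ℝ] (ℝ → ℝ))
    (hG : ∀ x v, ContDiff ℝ 2 (G x v)) (A : Finset ℝ) (hA : A.Nonempty) :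
    ∃ Φ : V →ₗ[ℝ] (ℝ → ℝ), (∀ v, ContDiff ℝ 2 (Φ v)) ∧ (∀ x ∈ A, ∀ v, Φ v x = G x v x) ∧
      (∀ x ∈ A, (∀ y ∈ A, y ≤ x) → ∀ v, ∀ t, x ≤ t → Φ v t = G x v t) ∧
      ∀ t, ∃ a ∈ A, ∃ b ∈ A, (a = b ∨ a < b ∧ a ≤ t ∧ t ≤ b) ∧
        ∀ v, Φ v =ᶠ[nhds t] blend a b (G a v) (G b v) := by
  induction A using Finset.induction_on_max with
  | empty => simp at hA
  | insert z A hz ih =>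
    rcases A.eq_empty_or_nonempty with rfl | hne
    · refine ⟨G z, hG z, by simp, by simp, fun t => ⟨z, by simp, z, by simp, Or.inl rfl,
        fun v => Filter.Eventually.of_forall fun u => by simp [blend]⟩⟩
    obtain ⟨Φ, hΦ, hval, htail, hloc⟩ := ih hne
    obtain ⟨x, hx, hmax⟩ : ∃ x ∈ A, ∀ y ∈ A, y ≤ x :=
      ⟨A.max' hne, A.max'_mem hne, fun y hy => A.le_max' y hy⟩
    have hxz : x < z := hz x hx
    have hpos : 0 < z - x := sub_pos.2 hxz
    set Ψ : V →ₗ[ℝ] (ℝ → ℝ) := Φ +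
      (LinearMap.mulLeft ℝ (fun t => smoothStep ((t - x) / (z - x)))) ∘ₗ (G z - G x) with hΨ
    have hΨ_apply (v : V) (t : ℝ) :
        Ψ v t = Φ v t + smoothStep ((t - x) / (z - x)) * (G z v t - G x v t) := by
      simp [hΨ]
    have hleft (v : V) (t : ℝ) (ht : (t - x) / (z - x) ≤ 1 / 3) : Ψ v t = Φ v t := by
      rw [hΨ_apply, smoothStep_eq_zero ht]; ring
    have hmid (v : V) (t : ℝ) (ht : x ≤ t) : Ψ v t = blend x z (G x v) (G z v) t := by
      rw [hΨ_apply, htail x hx hmax v t ht, blend]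
    have hright (v : V) (t : ℝ) (ht : z ≤ t) : Ψ v t = G z v t := by
      rw [hmid v t (hxz.le.trans ht), blend, smoothStep_eq_one]
      · ring
      · rw [le_div_iff₀ hpos]; linarith
    refine ⟨Ψ, fun v => ?_, fun y hy v => ?_, fun y hy hymax v t ht => ?_, fun t => ?_⟩
    · rw [show Ψ v = fun t => _ from funext (hΨ_apply v)]
      exact (hΦ v).add ((contDiff_smoothStep.comp (by fun_prop)).mul ((hG z v).sub (hG x v)))
    · rcases Finset.mem_insert.1 hy with rfl | hy
      · exact hright v y le_rfl
      · rw [hleft v y, hval y hy]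
        exact (div_nonpos_of_nonpos_of_nonneg (sub_nonpos.2 (hmax y hy)) hpos.le).trans
          (by norm_num)
    · have hyz : y = z := by
        rcases Finset.mem_insert.1 hy with rfl | hy
        · rfl
        · exact absurd (hymax z (Finset.mem_insert_self _ _)) (not_le.2 (hz y hy))
      subst hyz
      exact hright v t ht
    · rcases le_or_gt t x with ht | ht
      · obtain ⟨a, ha, b, hb, hab, h⟩ := hloc t
        refine ⟨a, Finset.mem_insert_of_mem ha, b, Finset.mem_insert_of_mem hb, hab,
          fun v => Filter.EventuallyEq.trans ?_ (h v)⟩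
        filter_upwards [Iio_mem_nhds (show t < x + (z - x) / 3 by linarith)] with u hu
        refine hleft v u ?_
        rw [div_le_iff₀ hpos]
        linarith [Set.mem_Iio.1 hu]
      · rcases le_or_gt t z with htz | htz
        · refine ⟨x, Finset.mem_insert_of_mem hx, z, Finset.mem_insert_self _ _,
            Or.inr ⟨hxz, ht.le, htz⟩, fun v => ?_⟩
          filter_upwards [Ioi_mem_nhds ht] with u hu
          exact hmid v u (Set.mem_Ioi.1 hu).le
        · refine ⟨z, Finset.mem_insert_self _ _, z, Finset.mem_insert_self _ _, Or.inl rfl,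
            fun v => ?_⟩
          filter_upwards [Ioi_mem_nhds htz] with u hu
          rw [hright v u (Set.mem_Ioi.1 hu).le]
          simp [blend]

lemma C2BddBy1.nonneg {F : ℝ → ℝ} {M : ℝ} (hF : C2BddBy1 F M) : 0 ≤ M :=
  (abs_nonneg _).trans (hF.2 0).1

lemma C2BddBy1.hasDerivAt {F : ℝ → ℝ} {M : ℝ} (hF : C2BddBy1 F M) (t : ℝ) :
    HasDerivAt F (deriv F t) t :=
  (hF.1.differentiable (by norm_num) t).hasDerivAt

lemma C2BddBy1.abs_deriv_sub_le {F : ℝ → ℝ} {M : ℝ} (hF : C2BddBy1 F M) (x y : ℝ) :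
    |deriv F y - deriv F x| ≤ M * |y - x| :=
  convex_univ.norm_image_sub_le_of_norm_deriv_le (f := deriv F)
    (fun t _ => hF.1.deriv_of_two.differentiable (by norm_num) t)
    (fun t _ => (hF.2 t).2.2) (Set.mem_univ x) (Set.mem_univ y)

lemma C2BddBy1.abs_slope_sub_deriv_le {F : ℝ → ℝ} {M : ℝ} (hF : C2BddBy1 F M) {x y : ℝ}
    (hxy : y ≠ x) : |(F y - F x) / (y - x) - deriv F x| ≤ M * |x - y| := by
  have hM := hF.nonneg
  have key : |(F y - deriv F x * y) - (F x - deriv F x * x)| ≤ (M * |x - y|) * |y - x| := by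
    refine (convex_uIcc x y).norm_image_sub_le_of_norm_hasDerivWithin_le
      (f := fun t => F t - deriv F x * t) (f' := fun t => deriv F t - deriv F x * 1)
      (fun t _ => ((hF.hasDerivAt t).sub ((hasDerivAt_id t).const_mul _)).hasDerivWithinAt)
      (fun t ht => ?_) Set.left_mem_uIcc Set.right_mem_uIcc
    rw [mul_one, Real.norm_eq_abs]
    refine (hF.abs_deriv_sub_le x t).trans (mul_le_mul_of_nonneg_left ?_ hM)
    rw [abs_sub_comm x y]
    exact Set.abs_sub_left_of_mem_uIcc ht
  have hne : y - x ≠ 0 := sub_ne_zero.2 hxy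
  have : (F y - F x) / (y - x) - deriv F x =
      ((F y - deriv F x * y) - (F x - deriv F x * x)) / (y - x) := by
    field_simp; ring
  rw [this, abs_div, div_le_iff₀ (abs_pos.2 hne)]
  exact key

/-- A linear functional depending on two points of `E` and approximating the derivative at `x`
of any `C²` extension, with an error controlled by the distance to the other points of `E`. -/
lemma exists_approx_deriv (E : Finset ℝ) {x : ℝ} (hx : x ∈ E) :
    ∃ d : (ℝ → ℝ) →ₗ[ℝ] ℝ,
      (∃ y ∈ E, ∀ f g : ℝ → ℝ, f x = g x → f y = g y → d f = d g) ∧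
      ∀ (f F : ℝ → ℝ) (M : ℝ), (∀ t ∈ E, F t = f t) → C2BddBy1 F M →
        |d f - deriv F x| ≤ M ∧ ∀ y ∈ E, y ≠ x → |d f - deriv F x| ≤ M * |x - y| := by
  by_cases hclose : ∃ y ∈ E.erase x, |x - y| ≤ 1
  · obtain ⟨w, hw, hw1⟩ := hclose
    obtain ⟨y, hy, hmin⟩ := (E.erase x).exists_min_image (fun y => |x - y|) ⟨w, hw⟩
    have hyE := Finset.mem_of_mem_erase hy
    have hyx := Finset.ne_of_mem_erase hy
    refine ⟨(y - x)⁻¹ • ((LinearMap.proj y : (ℝ → ℝ) →ₗ[ℝ] ℝ) - LinearMap.proj x), ⟨y, hyE, ?_⟩, ?_⟩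
    · intro f g h1 h2
      simp [h1, h2]
    · intro f F M hfF hF
      have h := hF.abs_slope_sub_deriv_le hyx
      rw [hfF y hyE, hfF x hx, div_eq_inv_mul] at h
      have hM := hF.nonneg
      refine ⟨h.trans ?_, fun z hz hzx => h.trans ?_⟩
      · exact mul_le_of_le_one_right hM ((hmin w hw).trans hw1)
      · exact mul_le_mul_of_nonneg_left (hmin z (Finset.mem_erase.2 ⟨hzx, hz⟩)) hM
  · push Not at hclose
    refine ⟨0, ⟨x, hx, fun _ _ _ _ => rfl⟩, fun f F M _ hF => ?_⟩
    have h : |(0 : (ℝ → ℝ) →ₗ[ℝ] ℝ) f - deriv F x| ≤ M := by simpa using (hF.2 x).2.1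
    refine ⟨h, fun y hy hyx => h.trans (le_mul_of_one_le_right hF.nonneg ?_)⟩
    exact (hclose y (Finset.mem_erase.2 ⟨hyx, hy⟩)).le

/-- The function `c + d sin (t - x)`, whose `2`-jet at `x` is `(c, d, 0)`. -/
noncomputable def jetFun (x c d t : ℝ) : ℝ := c + d * Real.sin (t - x)

lemma contDiff_jetFun (x c d : ℝ) : ContDiff ℝ 2 (jetFun x c d) := by
  unfold jetFun
  fun_prop

lemma hasDerivAt_jetFun (x c d t : ℝ) :
    HasDerivAt (jetFun x c d) (d * Real.cos (t - x)) t := by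
  have h := ((((hasDerivAt_id t).sub_const x).sin).const_mul d).const_add c
  rw [mul_one] at h
  exact h

lemma deriv_jetFun (x c d : ℝ) : deriv (jetFun x c d) = fun t => d * Real.cos (t - x) :=
  funext fun t => (hasDerivAt_jetFun x c d t).deriv

lemma deriv_deriv_jetFun (x c d t : ℝ) :
    deriv (deriv (jetFun x c d)) t = -(d * Real.sin (t - x)) := by
  rw [deriv_jetFun]
  have h := ((((hasDerivAt_id t).sub_const x).cos).const_mul d).deriv
  rw [mul_one, mul_neg] at h
  exact h

lemma jetFun_bounds {x c d M : ℝ} (hc : |c| ≤ M) (hd : |d| ≤ 2 * M) (t : ℝ) :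
    |jetFun x c d t| ≤ 3 * M ∧ |deriv (jetFun x c d) t| ≤ 2 * M ∧
      |deriv (deriv (jetFun x c d)) t| ≤ 2 * M := by
  have h1 : |d * Real.sin (t - x)| ≤ 2 * M := by
    rw [abs_mul]
    exact (mul_le_of_le_one_right (abs_nonneg _) (Real.abs_sin_le_one _)).trans hd
  refine ⟨?_, ?_, ?_⟩
  · exact (abs_add_le _ _).trans (by linarith)
  · rw [deriv_jetFun, abs_mul]
    exact (mul_le_of_le_one_right (abs_nonneg _) (Real.abs_cos_le_one _)).trans hd
  · rw [deriv_deriv_jetFun, abs_neg]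
    exact h1

lemma abs_cos_sub_one_le (u : ℝ) : |Real.cos u - 1| ≤ |u| := by
  have := convex_univ.norm_image_sub_le_of_norm_hasDerivWithin_le (C := 1)
    (fun t _ => (Real.hasDerivAt_cos t).hasDerivWithinAt)
    (fun t _ => by simpa using Real.abs_sin_le_one t) (Set.mem_univ 0) (Set.mem_univ u)
  simpa using this

lemma jetFun_sub_bounds {F : ℝ → ℝ} {x d M h t : ℝ} (hF : C2BddBy1 F M)
    (hd : |d| ≤ 2 * M) (hdx : |d - deriv F x| ≤ M * h) (ht : |t - x| ≤ h) :
    |jetFun x (F x) d t - F t| ≤ 4 * M * h ^ 2 ∧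
      |deriv (jetFun x (F x) d) t - deriv F t| ≤ 4 * M * h := by
  have hM := hF.nonneg
  have hderiv : ∀ u ∈ Set.uIcc x t,
      |deriv (jetFun x (F x) d) u - deriv F u| ≤ 4 * M * h := by
    intro u hu
    have hux : |u - x| ≤ h := (Set.abs_sub_left_of_mem_uIcc hu).trans ht
    have h1 : |d * (Real.cos (u - x) - 1)| ≤ 2 * M * h := by
      rw [abs_mul]
      exact mul_le_mul hd ((abs_cos_sub_one_le _).trans hux) (abs_nonneg _) (by linarith)
    have h2 : |deriv F u - deriv F x| ≤ M * h :=
      (hF.abs_deriv_sub_le x u).trans (mul_le_mul_of_nonneg_left hux hM)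
    rw [deriv_jetFun]
    rw [abs_le] at *
    constructor <;> linarith
  refine ⟨?_, hderiv t Set.right_mem_uIcc⟩
  have key := (convex_uIcc x t).norm_image_sub_le_of_norm_hasDerivWithin_le
    (f := fun u => jetFun x (F x) d u - F u)
    (fun u _ => (((hasDerivAt_jetFun x (F x) d u).sub (hF.hasDerivAt u)).hasDerivWithinAt))
    (fun u hu => by simpa only [deriv_jetFun, Real.norm_eq_abs] using hderiv u hu)
    Set.left_mem_uIcc Set.right_mem_uIcc
  have hx0 : jetFun x (F x) d x - F x = 0 := by simp [jetFun]
  simp only [hx0, sub_zero, Real.norm_eq_abs] at key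
  have hh : 0 ≤ h := (abs_nonneg _).trans ht
  calc _ ≤ 4 * M * h * |t - x| := key
    _ ≤ 4 * M * h * h := mul_le_mul_of_nonneg_left ht (by positivity)
    _ = _ := by ring

lemma deriv_blend {a b : ℝ} {P Q : ℝ → ℝ} (hP : ContDiff ℝ 2 P) (hQ : ContDiff ℝ 2 Q) :
    deriv (blend a b P Q) = fun t => deriv P t +
      (deriv smoothStep ((t - a) / (b - a)) * (1 / (b - a)) * (Q t - P t) +
        smoothStep ((t - a) / (b - a)) * (deriv Q t - deriv P t)) := by
  funext t
  have dP := (hP.differentiable (by norm_num) t).hasDerivAt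
  have dQ := (hQ.differentiable (by norm_num) t).hasDerivAt
  have ds := (contDiff_smoothStep.differentiable (by norm_num) ((t - a) / (b - a))).hasDerivAt
  have dl : HasDerivAt (fun t => (t - a) / (b - a)) (1 / (b - a)) t :=
    ((hasDerivAt_id t).sub_const a).div_const (b - a)
  exact (dP.add ((ds.comp t dl).mul (dQ.sub dP))).deriv

lemma deriv_deriv_blend {a b : ℝ} {P Q : ℝ → ℝ} (hP : ContDiff ℝ 2 P) (hQ : ContDiff ℝ 2 Q)
    (t : ℝ) :
    deriv (deriv (blend a b P Q)) t = deriv (deriv P) t +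
      (deriv (deriv smoothStep) ((t - a) / (b - a)) * (1 / (b - a)) * (1 / (b - a)) *
          (Q t - P t) +
        2 * (deriv smoothStep ((t - a) / (b - a)) * (1 / (b - a)) * (deriv Q t - deriv P t)) +
        smoothStep ((t - a) / (b - a)) * (deriv (deriv Q) t - deriv (deriv P) t)) := by
  rw [deriv_blend hP hQ]
  have dP := (hP.differentiable (by norm_num) t).hasDerivAt
  have dQ := (hQ.differentiable (by norm_num) t).hasDerivAt
  have dP' := (hP.deriv_of_two.differentiable (by norm_num) t).hasDerivAt
  have dQ' := (hQ.deriv_of_two.differentiable (by norm_num) t).hasDerivAt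
  have ds := (contDiff_smoothStep.differentiable (by norm_num) ((t - a) / (b - a))).hasDerivAt
  have ds' := (contDiff_smoothStep.deriv_of_two.differentiable (by norm_num)
    ((t - a) / (b - a))).hasDerivAt
  have dl : HasDerivAt (fun t => (t - a) / (b - a)) (1 / (b - a)) t :=
    ((hasDerivAt_id t).sub_const a).div_const (b - a)
  have key := dP'.add ((((ds'.comp t dl).mul_const (1 / (b - a))).mul (dQ.sub dP)).add
    ((ds.comp t dl).mul (dQ'.sub dP')))
  refine key.deriv.trans ?_
  simp only [Function.comp_apply, Pi.sub_apply]
  ring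

lemma abs_one_div_mul_le {D h N : ℝ} (hh : 0 ≤ h) (hD : |D| ≤ N) (hDh : |D| ≤ N * h) :
    |1 / h * D| ≤ N := by
  have hN : 0 ≤ N := (abs_nonneg _).trans hD
  rcases hh.eq_or_lt with rfl | hpos
  · simpa using hN
  · rw [one_div_mul_eq_div, abs_div, abs_of_pos hpos, div_le_iff₀ hpos]
    exact hDh

lemma blend_bounds {a b t M K : ℝ} {P Q : ℝ → ℝ} (hab : a ≤ b)
    (hK : ∀ u, |deriv smoothStep u| ≤ K ∧ |deriv (deriv smoothStep) u| ≤ K)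
    (hP : ContDiff ℝ 2 P) (hQ : ContDiff ℝ 2 Q)
    (bP : |P t| ≤ 3 * M ∧ |deriv P t| ≤ 2 * M ∧ |deriv (deriv P) t| ≤ 2 * M)
    (bQ : |Q t| ≤ 3 * M ∧ |deriv Q t| ≤ 2 * M ∧ |deriv (deriv Q) t| ≤ 2 * M)
    (h0 : |Q t - P t| ≤ 8 * M * (b - a) ^ 2)
    (h1 : |deriv Q t - deriv P t| ≤ 8 * M * (b - a)) :
    |blend a b P Q t| ≤ (9 + 24 * K) * M ∧ |deriv (blend a b P Q) t| ≤ (9 + 24 * K) * M ∧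
      |deriv (deriv (blend a b P Q)) t| ≤ (9 + 24 * K) * M := by
  obtain ⟨p0, p1, p2⟩ := bP
  obtain ⟨q0, q1, q2⟩ := bQ
  have hM : 0 ≤ M := by linarith [abs_nonneg (P t)]
  have hh : 0 ≤ b - a := sub_nonneg.2 hab
  set u := (t - a) / (b - a) with hu
  obtain ⟨k1, k2⟩ := hK u
  have hK0 : 0 ≤ K := (abs_nonneg _).trans k1
  have hKM : 0 ≤ K * M := mul_nonneg hK0 hM
  have d0 : |Q t - P t| ≤ 8 * M := by
    have := abs_sub (Q t) (P t); linarith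
  have d1 : |deriv Q t - deriv P t| ≤ 8 * M := by
    have := abs_sub (deriv Q t) (deriv P t); linarith
  have d2 : |deriv (deriv Q) t - deriv (deriv P) t| ≤ 4 * M := by
    have := abs_sub (deriv (deriv Q) t) (deriv (deriv P) t); linarith
  have d0h : |Q t - P t| ≤ 8 * M * (b - a) := by
    rcases le_total (b - a) 1 with h | h
    · refine h0.trans (mul_le_mul_of_nonneg_left ?_ (by positivity))
      nlinarith
    · exact d0.trans (le_mul_of_one_le_right (by positivity) h)
  have e0 : |1 / (b - a) * (Q t - P t)| ≤ 8 * M := abs_one_div_mul_le hh d0 d0h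
  have e1 : |1 / (b - a) * (deriv Q t - deriv P t)| ≤ 8 * M := abs_one_div_mul_le hh d1 h1
  have e00 : |1 / (b - a) * (1 / (b - a) * (Q t - P t))| ≤ 8 * M := by
    refine abs_one_div_mul_le hh e0 ?_
    rcases hh.eq_or_lt with h | h
    · simp [← h]
    · rw [one_div_mul_eq_div, abs_div, abs_of_pos h, div_le_iff₀ h]
      linarith [h0, sq (b - a)]
  have step (D : ℝ) (N : ℝ) (hD : |D| ≤ N) : |smoothStep u * D| ≤ N := by
    rw [abs_mul]
    exact (mul_le_of_le_one_left (abs_nonneg _) (abs_smoothStep_le_one u)).trans hD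
  have mulK (c D : ℝ) (hc : |c| ≤ K) (hD : |D| ≤ 8 * M) : |c * D| ≤ 8 * (K * M) := by
    rw [abs_mul]
    calc |c| * |D| ≤ K * (8 * M) := mul_le_mul hc hD (abs_nonneg _) hK0
      _ = _ := by ring
  have s0 := step _ _ (show |Q t - P t| ≤ 6 * M by
    have := abs_sub (Q t) (P t); linarith)
  have s1 := step _ _ (show |deriv Q t - deriv P t| ≤ 4 * M by
    have := abs_sub (deriv Q t) (deriv P t); linarith)
  have s2 := step _ _ d2
  have m0 := mulK _ _ k1 e0
  have m1 := mulK _ _ k1 e1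
  have m2 := mulK _ _ k2 e00
  rw [deriv_deriv_blend hP hQ, deriv_blend hP hQ, blend, ← hu]
  refine ⟨?_, ?_, ?_⟩
  · rw [abs_le] at *; constructor <;> linarith
  · simp only [← hu, mul_assoc] at *
    rw [abs_le] at *; constructor <;> linarith
  · simp only [mul_assoc] at *
    rw [abs_le] at *; constructor <;> linarith

lemma exists_hasCompactSupport_interpolant (A : Finset ℝ) (f : ℝ → ℝ) :
    ∃ F : ℝ → ℝ, ContDiff ℝ 2 F ∧ HasCompactSupport F ∧ ∀ x ∈ A, F x = f x := by
  induction A using Finset.induction_on with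
  | empty => exact ⟨0, contDiff_const, HasCompactSupport.zero, by simp⟩
  | insert x A hx ih =>
    obtain ⟨F, hF, hc, hval⟩ := ih
    have hnhds : (A : Set ℝ)ᶜ ∈ nhds x := A.finite_toSet.isClosed.isOpen_compl.mem_nhds hx
    obtain ⟨φ, hφ, hφc, hφs, -, hφx⟩ := exists_contDiff_tsupport_subset (n := 2) hnhds
    refine ⟨fun t => F t + (f x - F x) * φ t, hF.add (contDiff_const.mul hφs),
      hc.add hφc.mul_left, fun y hy => ?_⟩
    rcases Finset.mem_insert.1 hy with rfl | hy
    · simp [hφx]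
    · have : φ y = 0 := image_eq_zero_of_notMem_tsupport fun h => hφ h hy
      simp [this, hval y hy]

lemma exists_c2BddBy1_interpolant (A : Finset ℝ) (f : ℝ → ℝ) :
    ∃ M F, (∀ t ∈ A, F t = f t) ∧ C2BddBy1 F M := by
  obtain ⟨F, hF, hc, hval⟩ := exists_hasCompactSupport_interpolant A f
  obtain ⟨M₀, h₀⟩ := exists_bound_of_hasCompactSupport hF.continuous hc
  obtain ⟨M₁, h₁⟩ := exists_bound_of_hasCompactSupport hF.deriv_of_two.continuous hc.deriv
  obtain ⟨M₂, h₂⟩ := exists_bound_of_hasCompactSupport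
    (hF.deriv_of_two.continuous_deriv le_rfl) hc.deriv.deriv
  refine ⟨max M₀ (max M₁ M₂), F, hval, hF, fun t => ⟨?_, ?_, ?_⟩⟩
  · exact (h₀ t).trans (le_max_left _ _)
  · exact (h₁ t).trans ((le_max_left _ _).trans (le_max_right _ _))
  · exact (h₂ t).trans ((le_max_right _ _).trans (le_max_right _ _))

lemma le_mul_traceNorm1 {A : Finset ℝ} {f : ℝ → ℝ} {C v : ℝ} (hC : 0 < C)
    (h : ∀ M F, (∀ t ∈ A, F t = f t) → C2BddBy1 F M → v ≤ C * M) :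
    v ≤ C * traceNorm1 A f := by
  rw [← div_le_iff₀' hC]
  refine le_csInf ?_ ?_
  · obtain ⟨M, F, hval, hF⟩ := exists_c2BddBy1_interpolant A f
    exact ⟨M, hF.nonneg, F, hval, hF⟩
  · rintro M ⟨-, F, hval, hF⟩
    rw [div_le_iff₀' hC]
    exact h M F hval hF

/-- The two-jet at `t` of a linear family of `C²` functions, as a linear map. -/
noncomputable def jetMap {V : Type*} [AddCommGroup V] [Module ℝ V] (Φ : V →ₗ[ℝ] (ℝ → ℝ))
    (hΦ : ∀ v, ContDiff ℝ 2 (Φ v)) (t : ℝ) : V →ₗ[ℝ] ℝ × ℝ × ℝ where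
  toFun v := (Φ v t, deriv (Φ v) t, deriv (deriv (Φ v)) t)
  map_add' v w := by
    have h1 : deriv (Φ v + Φ w) = deriv (Φ v) + deriv (Φ w) := funext fun u =>
      deriv_add ((hΦ v).differentiable (by norm_num) u) ((hΦ w).differentiable (by norm_num) u)
    have h2 := deriv_add ((hΦ v).deriv_of_two.differentiable (by norm_num) t)
      ((hΦ w).deriv_of_two.differentiable (by norm_num) t)
    simp [h1, h2]
  map_smul' c v := by
    have h1 : deriv (c • Φ v) = c • deriv (Φ v) := funext fun u =>
      deriv_const_smul c ((hΦ v).differentiable (by norm_num) u)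
    have h2 := deriv_const_smul c ((hΦ v).deriv_of_two.differentiable (by norm_num) t)
    simp [h1, h2]

/-- One-dimensional bounded-depth *linear* `C²`
interpolation: linear jet maps `Ξ±ᵗ` (a two-jet is encoded as the triple of the
value and the first two derivatives) realized by a single interpolant. -/
theorem statement17 :
    ∃ (C : ℝ) (D₀ : ℕ), 0 < C ∧
      ∀ E₀ : Set ℝ, E₀.Finite →
        ∃ Ξ : ℝ → ((ℝ → ℝ) →ₗ[ℝ] ℝ × ℝ × ℝ),
          (∀ t : ℝ, ∃ S : Set ℝ, S ⊆ E₀ ∧ S.ncard ≤ D₀ ∧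
            ∀ f g : ℝ → ℝ, Set.EqOn f g S → Ξ t f = Ξ t g) ∧
          (∀ f : ℝ → ℝ,
            ∃ F : ℝ → ℝ, ContDiff ℝ 2 F ∧
              (∀ t : ℝ, F t = (Ξ t f).1 ∧ deriv F t = (Ξ t f).2.1 ∧
                deriv (deriv F) t = (Ξ t f).2.2) ∧
              (∀ t : ℝ, |F t| ≤ C * traceNorm1 E₀ f ∧
                |deriv F t| ≤ C * traceNorm1 E₀ f ∧
                |deriv (deriv F) t| ≤ C * traceNorm1 E₀ f) ∧
              (∀ t ∈ E₀, F t = f t)) := by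
  obtain ⟨K, hK0, hK⟩ := exists_bound_deriv_smoothStep
  have hC : 0 < 9 + 24 * K := by positivity
  refine ⟨9 + 24 * K, 4, hC, fun E₀ hE₀ => ?_⟩
  obtain ⟨A, rfl⟩ : ∃ A : Finset ℝ, (A : Set ℝ) = E₀ := ⟨hE₀.toFinset, hE₀.coe_toFinset⟩
  rcases A.eq_empty_or_nonempty with rfl | hne
  · refine ⟨fun _ => 0, fun t => ⟨∅, by simp, by simp, fun _ _ _ => rfl⟩, fun f =>
      ⟨fun _ => 0, contDiff_const, by simp, fun t => ?_, by simp⟩⟩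
    have h : (0 : ℝ) ≤ (9 + 24 * K) * traceNorm1 ↑(∅ : Finset ℝ) f :=
      le_mul_traceNorm1 hC fun M F _ hF => mul_nonneg hC.le hF.nonneg
    simpa using h
  have hd : ∀ x, ∃ d : (ℝ → ℝ) →ₗ[ℝ] ℝ, x ∈ A →
      (∃ y ∈ A, ∀ f g : ℝ → ℝ, f x = g x → f y = g y → d f = d g) ∧
      ∀ (f F : ℝ → ℝ) (M : ℝ), (∀ t ∈ A, F t = f t) → C2BddBy1 F M →
        |d f - deriv F x| ≤ M ∧ ∀ y ∈ A, y ≠ x → |d f - deriv F x| ≤ M * |x - y| := by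
    intro x
    by_cases hx : x ∈ A
    · obtain ⟨d, h⟩ := exists_approx_deriv A hx
      exact ⟨d, fun _ => h⟩
    · exact ⟨0, fun h => absurd h hx⟩
  choose d hd using hd
  let G (x : ℝ) : (ℝ → ℝ) →ₗ[ℝ] (ℝ → ℝ) := LinearMap.pi fun t =>
    LinearMap.proj x + Real.sin (t - x) • d x
  have hG_apply (x : ℝ) (f : ℝ → ℝ) : G x f = jetFun x (f x) (d x f) := by
    funext t
    simp [G, jetFun, mul_comm]
  have hG (x : ℝ) (f : ℝ → ℝ) : ContDiff ℝ 2 (G x f) := by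
    rw [hG_apply]
    exact contDiff_jetFun _ _ _
  obtain ⟨Φ, hΦ, hval, -, hloc⟩ := exists_glue G hG A hne
  refine ⟨jetMap Φ hΦ, fun t => ?_, fun f => ⟨Φ f, hΦ f, fun t => ⟨rfl, rfl, rfl⟩,
    fun t => ?_, fun x hx => ?_⟩⟩
  · obtain ⟨a, ha, b, hb, -, hblend⟩ := hloc t
    obtain ⟨a', ha', hda⟩ := (hd a ha).1
    obtain ⟨b', hb', hdb⟩ := (hd b hb).1
    refine ⟨(({a, a', b, b'} : Finset ℝ) : Set ℝ), ?_, ?_, fun f g hfg => ?_⟩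
    · intro y hy
      simp only [Finset.coe_insert, Finset.coe_singleton, Set.mem_insert_iff,
        Set.mem_singleton_iff] at hy
      rcases hy with rfl | rfl | rfl | rfl <;> assumption
    · rw [Set.ncard_coe_finset]
      exact Finset.card_le_four
    · have hGa : G a f = G a g := by
        rw [hG_apply, hG_apply, hfg (by simp), hda f g (hfg (by simp)) (hfg (by simp))]
      have hGb : G b f = G b g := by
        rw [hG_apply, hG_apply, hfg (by simp), hdb f g (hfg (by simp)) (hfg (by simp))]
      have h : Φ f =ᶠ[nhds t] Φ g :=
        (hblend f).trans (by rw [hGa, hGb]; exact (hblend g).symm)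
      exact Prod.ext h.eq_of_nhds (Prod.ext h.deriv_eq h.deriv.deriv_eq)
  · have main (M : ℝ) (F : ℝ → ℝ) (hFf : ∀ t ∈ A, F t = f t) (hF : C2BddBy1 F M) :
        |Φ f t| ≤ (9 + 24 * K) * M ∧ |deriv (Φ f) t| ≤ (9 + 24 * K) * M ∧
          |deriv (deriv (Φ f)) t| ≤ (9 + 24 * K) * M := by
      obtain ⟨a, ha, b, hb, hab, hblend⟩ := hloc t
      have h := hblend f
      rw [h.eq_of_nhds, h.deriv_eq, h.deriv.deriv_eq, hG_apply, hG_apply]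
      have bd (x : ℝ) (hx : x ∈ A) : |d x f| ≤ 2 * M := by
        have h1 := ((hd x hx).2 f F M hFf hF).1
        have h2 := (hF.2 x).2.1
        rw [abs_le] at *
        constructor <;> linarith
      have bf (x : ℝ) (hx : x ∈ A) : |f x| ≤ M := hFf x hx ▸ (hF.2 x).1
      have hM := hF.nonneg
      have close : |jetFun b (f b) (d b f) t - jetFun a (f a) (d a f) t| ≤
            8 * M * (b - a) ^ 2 ∧
          |deriv (jetFun b (f b) (d b f)) t - deriv (jetFun a (f a) (d a f)) t| ≤
            8 * M * (b - a) := by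
        rcases hab with rfl | ⟨hlt, hat, htb⟩
        · simp
        have hA := ((hd a ha).2 f F M hFf hF).2 b hb hlt.ne'
        have hB := ((hd b hb).2 f F M hFf hF).2 a ha hlt.ne
        rw [abs_sub_comm a b, abs_of_pos (sub_pos.2 hlt)] at hA
        rw [abs_of_pos (sub_pos.2 hlt)] at hB
        have jA := jetFun_sub_bounds (t := t) hF (bd a ha) hA
          (abs_le.2 ⟨by linarith, by linarith⟩)
        have jB := jetFun_sub_bounds (t := t) hF (bd b hb) hB
          (abs_le.2 ⟨by linarith, by linarith⟩)
        rw [hFf a ha] at jA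
        rw [hFf b hb] at jB
        simp only [abs_le] at *
        exact ⟨⟨by linarith, by linarith⟩, ⟨by linarith, by linarith⟩⟩
      exact blend_bounds (hab.elim (fun h => h.le) fun h => h.1.le) hK
        (contDiff_jetFun _ _ _) (contDiff_jetFun _ _ _)
        (jetFun_bounds (bf a ha) (bd a ha) t) (jetFun_bounds (bf b hb) (bd b hb) t)
        close.1 close.2
    exact ⟨le_mul_traceNorm1 hC fun M F h1 h2 => (main M F h1 h2).1,
      le_mul_traceNorm1 hC fun M F h1 h2 => (main M F h1 h2).2.1,
      le_mul_traceNorm1 hC fun M F h1 h2 => (main M F h1 h2).2.2⟩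
  · rw [hval x hx, hG_apply]
    simp [jetFun]
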